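/- arXiv:2005.13536 — 7 statements merged into one kernel-verified Lean document; each statement's English description precedes it below -/
import Mathlib

section
/- Let (A,∗) be an anti-flexible algebra over a field F of characteristic 0 and let α : A → A be a linear map. Define two bilinear products on A by x ≻ y := α(x) ∗ y and x ≺ y := x ∗ α(y). Then (A, ≺, ≻) is a pre-anti-flexible algebra if and only if for all x, y, z ∈ A: (α(x) ∗ α(y) − α(x ∗ α(y) + α(x) ∗ y)) ∗ z + z ∗ (α(y) ∗ α(x) − α(y ∗ α(x) + α(y) ∗ x)) = 0. -/
/-- Anti-flexible algebra structure on a bilinear product. -/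
def IsAntiFlexible {F A : Type*} [Field F] [AddCommGroup A] [Module F A]
    (m : A →ₗ[F] A →ₗ[F] A) : Prop :=
  ∀ x y z : A, m (m x y) z - m x (m y z) = m (m z y) x - m z (m y x)

/-- Pre-anti-flexible algebra structure on a pair of bilinear products `(≺, ≻) = (p, s)`. -/
def IsPreAntiFlexible {F A : Type*} [Field F] [AddCommGroup A] [Module F A]
    (p s : A →ₗ[F] A →ₗ[F] A) : Prop :=
  (∀ x y z : A, p (s x y) z - s x (p y z) = p (s z y) x - s z (p y x)) ∧
  (∀ x y z : A, s (p x y + s x y) z - s x (s y z) = p (p z y) x - p z (p y x + s y x))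

/-- for an anti-flexible algebra `(A, m)` and a linear map `α`, the products
`x ≻ y = α(x) ∗ y` and `x ≺ y = x ∗ α(y)` form a pre-anti-flexible algebra iff
`(α(x)∗α(y) − α(x∗α(y) + α(x)∗y))∗z + z∗(α(y)∗α(x) − α(y∗α(x) + α(y)∗x)) = 0`. -/
theorem preAntiFlexible_of_linearMap_iff
    {F A : Type*} [Field F] [CharZero F] [AddCommGroup A] [Module F A]
    (m : A →ₗ[F] A →ₗ[F] A) (hm : IsAntiFlexible m) (α : A →ₗ[F] A) :
    IsPreAntiFlexible (m.compl₂ α) (m.comp α) ↔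
      ∀ x y z : A,
        m (m (α x) (α y) - α (m x (α y) + m (α x) y)) z
          + m z (m (α y) (α x) - α (m y (α x) + m (α y) x)) = 0 := by
  simp only [IsPreAntiFlexible, LinearMap.compl₂_apply, LinearMap.comp_apply]
  refine ⟨fun h x y z => ?_, fun h => ⟨fun x y z => hm (α x) y (α z), fun x y z => ?_⟩⟩
  · have hs := h.2 x y z
    have ha := hm (α x) (α y) z
    simp only [map_sub, LinearMap.sub_apply]
    grind
  · have he := h x y z
    have ha := hm (α x) (α y) z
    simp only [map_sub, LinearMap.sub_apply] at he
    grind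
end

section
/- Let (A,∗) be an anti-flexible algebra over a field F of characteristic 0 and let R : A → A be a Rota–Baxter operator of weight zero, i.e. R(x) ∗ R(y) = R(x ∗ R(y) + R(x) ∗ y) for all x,y ∈ A. Then the products x ≻ y := R(x) ∗ y and x ≺ y := x ∗ R(y) make (A, ≺, ≻) a pre-anti-flexible algebra. -/
/-- a Rota–Baxter operator of weight zero `R` on an anti-flexible algebra `(A, m)`
induces a pre-anti-flexible algebra via `x ≻ y = R(x) ∗ y`, `x ≺ y = x ∗ R(y)`. -/
theorem preAntiFlexible_of_rotaBaxter
    {F A : Type*} [Field F] [CharZero F] [AddCommGroup A] [Module F A]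
    (m : A →ₗ[F] A →ₗ[F] A) (hm : IsAntiFlexible m) (R : A →ₗ[F] A)
    (hR : ∀ x y : A, m (R x) (R y) = R (m x (R y) + m (R x) y)) :
    IsPreAntiFlexible (m.compl₂ R) (m.comp R) := by
  refine ⟨fun x y z => ?_, fun x y z => ?_⟩
  · simpa only [LinearMap.compl₂_apply, LinearMap.comp_apply] using hm (R x) y (R z)
  · simpa only [LinearMap.compl₂_apply, LinearMap.comp_apply, ← hR] using hm (R x) (R y) z
end

section
/- Let (A,≺,≻) be a pre-anti-flexible algebra over a field F of characteristic 0, V a vector space, and l≻, r≻, l≺, r≺ : A → End(V) four linear maps. Then (l≻, r≻, l≺, r≺, V) is a bimodule of (A,≺,≻) if and only if the products (x+u) ≺' (y+v) := x≺y + l≺(x)v + r≺(y)u and (x+u) ≻' (y+v) := x≻y + l≻(x)v + r≻(y)u (x,y ∈ A, u,v ∈ V) make the direct sum A ⊕ V a pre-anti-flexible algebra. -/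
/-- Bimodule of a pre-anti-flexible algebra `(A, p, s)`: a quintuple `(ls, rs, lp, rp, V)`,
i.e. `(l≻, r≻, l≺, r≺, V)`, satisfying the five compatibility identities. -/
def IsPAFBimodule {F A V : Type*} [Field F] [AddCommGroup A] [Module F A]
    [AddCommGroup V] [Module F V] (p s : A →ₗ[F] A →ₗ[F] A)
    (ls rs lp rp : A →ₗ[F] Module.End F V) : Prop :=
  (∀ x y : A, rp x * ls y - ls y * rp x = rp y * ls x - ls x * rp y) ∧
  (∀ x y : A, lp (s x y) - ls x * lp y = rp x * rs y - rs (p y x)) ∧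
  (∀ x y : A, ls (p x y + s x y) - ls x * ls y = rp x * rp y - rp (p y x + s y x)) ∧
  (∀ x y : A, rs x * (lp y + ls y) - ls y * rs x = rp y * lp x - lp x * (rp y + rs y)) ∧
  (∀ x y : A, rs x * (rp y + rs y) - rs (s y x) = lp (p x y) - lp x * (lp y + ls y))

/-- The product on `A × V` induced by a product on `A` and left/right actions on `V`:
`(x,u)·(y,v) = (x·y, l(x)v + r(y)u)`. -/
def pairMul {F A V : Type*} [Field F] [AddCommGroup A] [Module F A]
    [AddCommGroup V] [Module F V]
    (m : A →ₗ[F] A →ₗ[F] A) (l r : A →ₗ[F] Module.End F V) :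
    (A × V) →ₗ[F] (A × V) →ₗ[F] (A × V) :=
  LinearMap.mk₂ F (fun z w => (m z.1 w.1, l z.1 w.2 + r w.1 z.2))
    (by intro z z' w; simp [Prod.ext_iff]; abel)
    (by intro c z w; simp [Prod.ext_iff, smul_add])
    (by intro z w w'; simp [Prod.ext_iff]; abel)
    (by intro c z w; simp [Prod.ext_iff, smul_add])

@[simp]
theorem pairMul_apply {F A V : Type*} [Field F] [AddCommGroup A] [Module F A]
    [AddCommGroup V] [Module F V]
    (m : A →ₗ[F] A →ₗ[F] A) (l r : A →ₗ[F] Module.End F V) (z w : A × V) :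
    pairMul m l r z w = (m z.1 w.1, l z.1 w.2 + r w.1 z.2) := rfl

/-- `(l≻, r≻, l≺, r≺, V)` is a bimodule of the pre-anti-flexible algebra
`(A, ≺, ≻)` iff the induced products make `A ⊕ V` a pre-anti-flexible algebra. -/
theorem isPAFBimodule_iff_pair_preAntiFlexible
    {F A V : Type*} [Field F] [CharZero F] [AddCommGroup A] [Module F A]
    [AddCommGroup V] [Module F V]
    (p s : A →ₗ[F] A →ₗ[F] A) (hps : IsPreAntiFlexible p s)
    (ls rs lp rp : A →ₗ[F] Module.End F V) :
    IsPAFBimodule p s ls rs lp rp ↔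
      IsPreAntiFlexible (pairMul p lp rp) (pairMul s ls rs) := by
  constructor
  · rintro ⟨h₁, h₂, h₃, h₄, h₅⟩
    refine ⟨fun ⟨x, u⟩ ⟨y, v⟩ ⟨z, w⟩ => Prod.ext (hps.1 x y z) ?_,
      fun ⟨x, u⟩ ⟨y, v⟩ ⟨z, w⟩ => Prod.ext (hps.2 x y z) ?_⟩
    · have e₁ := LinearMap.congr_fun (h₁ z x) v
      have e₂ := LinearMap.congr_fun (h₂ x y) w
      have e₃ := LinearMap.congr_fun (h₂ z y) u
      simp only [LinearMap.sub_apply, Module.End.mul_apply] at e₁ e₂ e₃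
      simp only [pairMul_apply, Prod.snd_sub, map_add]
      linear_combination (norm := abel) e₁ + e₂ - e₃
    · have e₁ := LinearMap.congr_fun (h₃ x y) w
      have e₂ := LinearMap.congr_fun (h₄ z x) v
      have e₃ := LinearMap.congr_fun (h₅ z y) u
      simp only [LinearMap.sub_apply, LinearMap.add_apply, Module.End.mul_apply, map_add]
        at e₁ e₂ e₃
      simp only [pairMul_apply, Prod.snd_sub, Prod.mk_add_mk, map_add, LinearMap.add_apply]
      linear_combination (norm := abel) e₁ + e₂ + e₃
  · rintro ⟨h₁, h₂⟩
    refine ⟨fun x y => ?_, fun x y => ?_, fun x y => ?_, fun x y => ?_, fun x y => ?_⟩ <;>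
      ext v
    · simpa using congrArg Prod.snd (h₁ (y, 0) (0, v) (x, 0))
    · simpa using congrArg Prod.snd (h₁ (x, 0) (y, 0) (0, v))
    · simpa using congrArg Prod.snd (h₂ (x, 0) (y, 0) (0, v))
    · simpa using congrArg Prod.snd (h₂ (y, 0) (0, v) (x, 0))
    · simpa using congrArg Prod.snd (h₂ (0, v) (y, 0) (x, 0))
end

section
/- Let (l≻, r≻, l≺, r≺, V) be a bimodule of a pre-anti-flexible algebra (A,≺,≻) over a field F of characteristic 0, and set l· = l≺ + l≻ and r· = r≺ + r≻. Then (l·, r·, V) is a bimodule of the underlying anti-flexible algebra aF(A) = (A, ·) with x·y = x≺y + x≻y. -/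
/-- Bimodule of an anti-flexible algebra `(A, m)`. -/
def IsAFBimodule {F A V : Type*} [Field F] [AddCommGroup A] [Module F A]
    [AddCommGroup V] [Module F V]
    (m : A →ₗ[F] A →ₗ[F] A) (l r : A →ₗ[F] Module.End F V) : Prop :=
  (∀ x y : A, l (m x y) - l x * l y = r x * r y - r (m y x)) ∧
  (∀ x y : A, l x * r y - r y * l x = l y * r x - r x * l y)

/-- if `(l≻, r≻, l≺, r≺, V)` is a bimodule of a pre-anti-flexible algebra
`(A, ≺, ≻)`, then `(l≺+l≻, r≺+r≻, V)` is a bimodule of the underlying anti-flexible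
algebra `aF(A) = (A, ·)` with `x·y = x≺y + x≻y`. -/
theorem isAFBimodule_of_isPAFBimodule
    {F A V : Type*} [Field F] [CharZero F] [AddCommGroup A] [Module F A]
    [AddCommGroup V] [Module F V]
    (p s : A →ₗ[F] A →ₗ[F] A) (hps : IsPreAntiFlexible p s)
    (ls rs lp rp : A →ₗ[F] Module.End F V)
    (h : IsPAFBimodule p s ls rs lp rp) :
    IsAFBimodule (p + s) (lp + ls) (rp + rs) := by
  obtain ⟨h1, h2, h3, h4, h5⟩ := h
  refine ⟨fun x y => ?_, fun x y => ?_⟩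
  · simp only [LinearMap.add_apply]
    have e2 := h2 x y
    have e3 := h3 x y
    have e5 := h5 x y
    simp only [map_add] at e3 ⊢
    linear_combination (norm := noncomm_ring) e2 + e3 - e5
  · simp only [LinearMap.add_apply]
    linear_combination (norm := noncomm_ring) h4 x y - h4 y x + h1 x y
end

section
/- Let (l≻, r≻, l≺, r≺, V) be a bimodule of a pre-anti-flexible algebra (A,≺,≻) over a field F of characteristic 0, with V finite-dimensional, and set l· = l≺ + l≻ and r· = r≺ + r≻. Then (l≻, r≺, V), (r*·, l*·, V*) and (r*≺, l*≻, V*) are bimodules of the underlying anti-flexible algebra aF(A) = (A, ·) with x·y = x≺y + x≻y. -/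
/-- The dual representation `φ* : A → End(V*)`, `⟨φ*(x)u*, v⟩ = ⟨u*, φ(x)v⟩`. -/
def dualRep {F A V : Type*} [Field F] [AddCommGroup A] [Module F A]
    [AddCommGroup V] [Module F V] (φ : A →ₗ[F] Module.End F V) :
    A →ₗ[F] Module.End F (Module.Dual F V) :=
  (Module.Dual.transpose (R := F) (M := V) (M' := V)) ∘ₗ φ

theorem IsAFBimodule.dualRep {F A V : Type*} [Field F] [AddCommGroup A] [Module F A]
    [AddCommGroup V] [Module F V] {m : A →ₗ[F] A →ₗ[F] A} {l r : A →ₗ[F] Module.End F V}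
    (h : IsAFBimodule m l r) : IsAFBimodule m (dualRep r) (dualRep l) := by
  obtain ⟨h₁, h₂⟩ := h
  refine ⟨fun x y => ?_, fun x y => ?_⟩
  · ext u v
    have e := congrArg (fun f : Module.End F V => u (f v)) (h₁ y x)
    simp only [LinearMap.sub_apply, Module.End.mul_apply, map_sub] at e
    simp only [_root_.dualRep, LinearMap.sub_apply, Module.End.mul_apply, LinearMap.comp_apply,
      Module.Dual.transpose_apply]
    linear_combination e
  · ext u v
    have e := congrArg (fun f : Module.End F V => u (f v)) (h₂ x y)
    simp only [LinearMap.sub_apply, Module.End.mul_apply, map_sub] at e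
    simp only [_root_.dualRep, LinearMap.sub_apply, Module.End.mul_apply, LinearMap.comp_apply,
      Module.Dual.transpose_apply]
    linear_combination -e

theorem IsPAFBimodule.isAFBimodule_left_right {F A V : Type*} [Field F] [AddCommGroup A]
    [Module F A] [AddCommGroup V] [Module F V] {p s : A →ₗ[F] A →ₗ[F] A}
    {ls rs lp rp : A →ₗ[F] Module.End F V} (h : IsPAFBimodule p s ls rs lp rp) :
    IsAFBimodule (p + s) ls rp := by
  obtain ⟨h₁, -, h₃, -, -⟩ := h
  refine ⟨fun x y => by simpa only [LinearMap.add_apply] using h₃ x y, fun x y => ?_⟩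
  linear_combination (norm := abel) h₁ x y

theorem IsPAFBimodule.isAFBimodule_add {F A V : Type*} [Field F] [AddCommGroup A]
    [Module F A] [AddCommGroup V] [Module F V] {p s : A →ₗ[F] A →ₗ[F] A}
    {ls rs lp rp : A →ₗ[F] Module.End F V} (h : IsPAFBimodule p s ls rs lp rp) :
    IsAFBimodule (p + s) (lp + ls) (rp + rs) := by
  obtain ⟨h₁, h₂, h₃, h₄, h₅⟩ := h
  refine ⟨fun x y => ?_, fun x y => ?_⟩
  · have e₂ := h₂ x y
    have e₃ := h₃ x y
    have e₅ := h₅ x y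
    simp only [LinearMap.add_apply, map_add, mul_add, add_mul] at *
    linear_combination (norm := abel) e₂ + e₃ - e₅
  · have e₁ := h₁ x y
    have e₄ := h₄ x y
    have e₄' := h₄ y x
    simp only [LinearMap.add_apply, mul_add, add_mul] at *
    linear_combination (norm := abel) e₁ + e₄ - e₄'

/-- if `(l≻, r≻, l≺, r≺, V)` is a bimodule of a pre-anti-flexible algebra
`(A, ≺, ≻)` with `V` finite-dimensional, then `(l≻, r≺, V)`, `(r*·, l*·, V*)` and
`(r*≺, l*≻, V*)` are bimodules of the underlying anti-flexible algebra `(A, p+s)`. -/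
theorem isAFBimodules_of_isPAFBimodule_dual
    {F A V : Type*} [Field F] [CharZero F] [AddCommGroup A] [Module F A]
    [AddCommGroup V] [Module F V] [FiniteDimensional F V]
    (p s : A →ₗ[F] A →ₗ[F] A) (hps : IsPreAntiFlexible p s)
    (ls rs lp rp : A →ₗ[F] Module.End F V)
    (h : IsPAFBimodule p s ls rs lp rp) :
    IsAFBimodule (p + s) ls rp ∧
    IsAFBimodule (p + s) (dualRep (rp + rs)) (dualRep (lp + ls)) ∧
    IsAFBimodule (p + s) (dualRep rp) (dualRep ls) := by
  exact ⟨h.isAFBimodule_left_right, h.isAFBimodule_add.dualRep,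
    h.isAFBimodule_left_right.dualRep⟩
end

section
/- Let (A, ≺_A, ≻_A) be a finite-dimensional pre-anti-flexible algebra over a field F of characteristic 0 and suppose its dual space A* carries a pre-anti-flexible algebra structure (≺_{A*}, ≻_{A*}). Write x·y = x≺_A y + x≻_A y and a∘b = a≺_{A*} b + a≻_{A*} b. Define on A ⊕ A* the product (x+a) ⋆ (y+b) := (x·y + R*_{≺_{A*}}(a)y + L*_{≻_{A*}}(b)x) + (a∘b + R*_{≺_A}(x)b + L*_{≻_A}(y)a). If ⋆ makes A ⊕ A* an anti-flexible algebra, then the nondegenerate skew-symmetric bilinear form ω on A ⊕ A* defined by ω(x+a, y+b) := ⟨x, b⟩ − ⟨y, a⟩ satisfies ω(u ⋆ v, w) + ω(v ⋆ w, u) + ω(w ⋆ u, v) = 0 for all u, v, w ∈ A ⊕ A*. -/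
/-- Transfer an endomorphism of `Dual F A` to an endomorphism of `A` by dualizing and
identifying `A** ≅ A`: it satisfies `⟨f°(x), b⟩ = ⟨x, f(b)⟩`, i.e. `b (f° x) = (f b) x`. -/
noncomputable def dualEndOnBase {F A : Type*} [Field F] [AddCommGroup A] [Module F A]
    [FiniteDimensional F A] (f : Module.End F (Module.Dual F A)) : Module.End F A :=
  ((Module.evalEquiv F A).symm.conj :
      Module.End F (Module.Dual F (Module.Dual F A)) ≃ₗ[F] Module.End F A)
    (Module.Dual.transpose (R := F) f)

/-- The product `⋆` on `A ⊕ A*`: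
`(x+a) ⋆ (y+b) = (x·y + R'*≺(a)y + L'*≻(b)x) + (a∘b + R*≺(x)b + L*≻(y)a)`,
where `x·y = p x y + s x y` and `a∘b = p' a b + s' a b`. -/
noncomputable def starProd {F A : Type*} [Field F] [AddCommGroup A] [Module F A]
    [FiniteDimensional F A] (p s : A →ₗ[F] A →ₗ[F] A)
    (p' s' : Module.Dual F A →ₗ[F] Module.Dual F A →ₗ[F] Module.Dual F A) :
    (A × Module.Dual F A) →ₗ[F] (A × Module.Dual F A) →ₗ[F] (A × Module.Dual F A) :=
  LinearMap.mk₂ F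
    (fun z w =>
      (p z.1 w.1 + s z.1 w.1 + dualEndOnBase (p'.flip z.2) w.1 + dualEndOnBase (s' w.2) z.1,
       p' z.2 w.2 + s' z.2 w.2 + Module.Dual.transpose (R := F) (p.flip z.1) w.2
         + Module.Dual.transpose (R := F) (s w.1) z.2))
    (by intro z z' w; simp [Prod.ext_iff, dualEndOnBase, map_add]; constructor <;> abel)
    (by intro c z w; simp [Prod.ext_iff, dualEndOnBase, map_smul, smul_add])
    (by intro z w w'; simp [Prod.ext_iff, dualEndOnBase, map_add]; constructor <;> abel)
    (by intro c z w; simp [Prod.ext_iff, dualEndOnBase, map_smul, smul_add])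

/-- The defining pairing identity `⟨f°(x), b⟩ = ⟨x, f(b)⟩` of `dualEndOnBase`. -/
theorem apply_dualEndOnBase {F A : Type*} [Field F] [AddCommGroup A] [Module F A]
    [FiniteDimensional F A] (f : Module.End F (Module.Dual F A)) (b : Module.Dual F A) (x : A) :
    b (dualEndOnBase f x) = f b x := by
  simp [dualEndOnBase, LinearEquiv.conj_apply, Module.Dual.transpose_apply]

/-- if the product `⋆` makes `A ⊕ A*` an anti-flexible algebra, then the
skew-symmetric bilinear form `ω(x+a, y+b) = ⟨x,b⟩ − ⟨y,a⟩` is cyclically invariant: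
`ω(u⋆v, w) + ω(v⋆w, u) + ω(w⋆u, v) = 0`. -/
theorem starProd_omega_cocycle
    {F A : Type*} [Field F] [CharZero F] [AddCommGroup A] [Module F A]
    [FiniteDimensional F A]
    (p s : A →ₗ[F] A →ₗ[F] A) (hA : IsPreAntiFlexible p s)
    (p' s' : Module.Dual F A →ₗ[F] Module.Dual F A →ₗ[F] Module.Dual F A)
    (hA' : IsPreAntiFlexible p' s')
    (hstar : IsAntiFlexible (starProd p s p' s')) :
    ∀ u v w : A × Module.Dual F A,
      (w.2 (starProd p s p' s' u v).1 - (starProd p s p' s' u v).2 w.1)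
      + (u.2 (starProd p s p' s' v w).1 - (starProd p s p' s' v w).2 u.1)
      + (v.2 (starProd p s p' s' w u).1 - (starProd p s p' s' w u).2 v.1) = 0 := by
  rintro ⟨x, a⟩ ⟨y, b⟩ ⟨z, c⟩
  simp only [starProd, LinearMap.mk₂_apply, map_add, LinearMap.add_apply,
    apply_dualEndOnBase, Module.Dual.transpose_apply, LinearMap.comp_apply,
    LinearMap.flip_apply]
  ring
end

section
/- Let (A,≺,≻) be a finite-dimensional pre-anti-flexible algebra over a field F of characteristic 0 and let r ∈ A⊗A be symmetric and nondegenerate, with induced linear isomorphism r : A* → A. Then r satisfies the pre-anti-flexible Yang–Baxter equation r23·r12 = r12≺r13 + r13≻r23 if and only if the bilinear form B on A defined by B(x,y) := ⟨r⁻¹(x), y⟩ satisfies B(x·y, z) = B(y, z≺x) + B(x, y≻z) for all x, y, z ∈ A, where x·y = x≺y + x≻y. -/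
open TensorProduct

/-- The linear map sending `(x⊗y)⊗(z⊗w)` to `z ⊗ (m x w) ⊗ y`; applied to `r ⊗ r` it
yields `r23·r12 = Σ_{i,j} a_j ⊗ (a_i · b_j) ⊗ b_i`. -/
noncomputable def yb1 {F A : Type*} [Field F] [AddCommGroup A] [Module F A]
    (m : A →ₗ[F] A →ₗ[F] A) :
    ((A ⊗[F] A) ⊗[F] (A ⊗[F] A)) →ₗ[F] A ⊗[F] (A ⊗[F] A) :=
  (TensorProduct.map LinearMap.id
      (TensorProduct.map (TensorProduct.lift m) LinearMap.id))
    ∘ₗ (TensorProduct.map LinearMap.id (TensorProduct.assoc F A A A).symm.toLinearMap)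
    ∘ₗ (TensorProduct.assoc F A A (A ⊗[F] A)).toLinearMap
    ∘ₗ (TensorProduct.tensorTensorTensorComm F A A A A).toLinearMap
    ∘ₗ (TensorProduct.comm F (A ⊗[F] A) (A ⊗[F] A)).toLinearMap

/-- The linear map sending `(x⊗y)⊗(z⊗w)` to `(p x z) ⊗ y ⊗ w`; applied to `r ⊗ r` it
yields `r12 ≺ r13 = Σ_{i,j} (a_i ≺ a_j) ⊗ b_i ⊗ b_j`. -/
noncomputable def yb2 {F A : Type*} [Field F] [AddCommGroup A] [Module F A]
    (p : A →ₗ[F] A →ₗ[F] A) :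
    ((A ⊗[F] A) ⊗[F] (A ⊗[F] A)) →ₗ[F] A ⊗[F] (A ⊗[F] A) :=
  (TensorProduct.map (TensorProduct.lift p) LinearMap.id)
    ∘ₗ (TensorProduct.tensorTensorTensorComm F A A A A).toLinearMap

/-- The linear map sending `(x⊗y)⊗(z⊗w)` to `x ⊗ z ⊗ (s y w)`; applied to `r ⊗ r` it
yields `r13 ≻ r23 = Σ_{i,j} a_i ⊗ a_j ⊗ (b_i ≻ b_j)`. -/
noncomputable def yb3 {F A : Type*} [Field F] [AddCommGroup A] [Module F A]
    (s : A →ₗ[F] A →ₗ[F] A) :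
    ((A ⊗[F] A) ⊗[F] (A ⊗[F] A)) →ₗ[F] A ⊗[F] (A ⊗[F] A) :=
  (TensorProduct.assoc F A A A).toLinearMap
    ∘ₗ (TensorProduct.map LinearMap.id (TensorProduct.lift s))
    ∘ₗ (TensorProduct.tensorTensorTensorComm F A A A A).toLinearMap

/-- The pre-anti-flexible Yang–Baxter equation `r23·r12 = r12 ≺ r13 + r13 ≻ r23` for
`r ∈ A ⊗ A`, with product `x·y = p x y + s x y`. -/
noncomputable def IsPAFYBESolution {F A : Type*} [Field F] [AddCommGroup A] [Module F A]
    (p s : A →ₗ[F] A →ₗ[F] A) (r : A ⊗[F] A) : Prop :=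
  yb1 (p + s) (r ⊗ₜ[F] r) = yb2 p (r ⊗ₜ[F] r) + yb3 s (r ⊗ₜ[F] r)

/-- A tensor `r ∈ A ⊗ A` as a linear map `A* → A`, `⟨r(a), b⟩ = ⟨r, a ⊗ b⟩`. -/
noncomputable def rMapL {F A : Type*} [Field F] [AddCommGroup A] [Module F A] :
    (A ⊗[F] A) →ₗ[F] (Module.Dual F A →ₗ[F] A) :=
  (dualTensorHom F (Module.Dual F A) A)
    ∘ₗ (TensorProduct.map (Module.Dual.eval F A) LinearMap.id)

section Pairing

variable {F A : Type*} [Field F] [AddCommGroup A] [Module F A]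

/-- The pairing of `f ⊗ g ⊗ h` with a tensor of degree three. -/
noncomputable def tripleEval (f g h : Module.Dual F A) : Module.Dual F (A ⊗[F] (A ⊗[F] A)) :=
  TensorProduct.dualDistrib F A (A ⊗[F] A) (f ⊗ₜ TensorProduct.dualDistrib F A A (g ⊗ₜ h))

lemma tripleEval_tmul (f g h : Module.Dual F A) (x y z : A) :
    tripleEval f g h (x ⊗ₜ[F] (y ⊗ₜ[F] z)) = f x * (g y * h z) := by
  simp [tripleEval]

lemma tripleEval_ext [FiniteDimensional F A] {t u : A ⊗[F] (A ⊗[F] A)}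
    (htu : ∀ f g h : Module.Dual F A, tripleEval f g h t = tripleEval f g h u) : t = u := by
  let b := Module.finBasis F A
  refine (b.tensorProduct (b.tensorProduct b)).ext_elem fun ⟨i, j, k⟩ => ?_
  have key : (b.tensorProduct (b.tensorProduct b)).coord (i, j, k)
      = tripleEval (b.coord i) (b.coord j) (b.coord k) := by
    ext x y z
    simp [tripleEval_tmul, Module.Basis.tensorProduct_repr_tmul_apply, mul_comm]
  have := htu (b.coord i) (b.coord j) (b.coord k)
  rwa [← key] at this

lemma rMapL_tmul (x y : A) (f : Module.Dual F A) :
    rMapL (x ⊗ₜ[F] y) f = f x • y := by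
  simp [rMapL]

lemma dual_rMapL (r : A ⊗[F] A) (f g : Module.Dual F A) :
    f (rMapL r g) = g (rMapL (TensorProduct.comm F A A r) f) := by
  induction r with
  | zero => simp
  | tmul x y => simp [rMapL_tmul, mul_comm]
  | add r t hr ht => simp [hr, ht]

lemma tripleEval_yb1 (m : A →ₗ[F] A →ₗ[F] A) (r t : A ⊗[F] A) (f g h : Module.Dual F A) :
    tripleEval f g h (yb1 m (r ⊗ₜ[F] t))
      = g (m (rMapL (TensorProduct.comm F A A r) h) (rMapL t f)) := by
  induction r with
  | zero => simp
  | add r r' hr hr' => simp [TensorProduct.add_tmul, hr, hr']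
  | tmul x y =>
    induction t with
    | zero => simp
    | add t t' ht ht' => simp only [TensorProduct.tmul_add, map_add, LinearMap.add_apply, ht, ht']
    | tmul z w =>
      simp only [yb1, rMapL_tmul, tripleEval_tmul, LinearMap.comp_apply, LinearEquiv.coe_coe,
        TensorProduct.comm_tmul, TensorProduct.tensorTensorTensorComm_tmul,
        TensorProduct.assoc_tmul, TensorProduct.assoc_symm_tmul, TensorProduct.map_tmul,
        TensorProduct.lift.tmul, LinearMap.id_apply, map_smul, LinearMap.smul_apply, smul_eq_mul]
      ring

lemma tripleEval_yb2 (p : A →ₗ[F] A →ₗ[F] A) (r t : A ⊗[F] A) (f g h : Module.Dual F A) :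
    tripleEval f g h (yb2 p (r ⊗ₜ[F] t))
      = f (p (rMapL (TensorProduct.comm F A A r) g)
          (rMapL (TensorProduct.comm F A A t) h)) := by
  induction r with
  | zero => simp
  | add r r' hr hr' => simp [TensorProduct.add_tmul, hr, hr']
  | tmul x y =>
    induction t with
    | zero => simp
    | add t t' ht ht' => simp only [TensorProduct.tmul_add, map_add, LinearMap.add_apply, ht, ht']
    | tmul z w => simp [yb2, rMapL_tmul, tripleEval_tmul]; ring

lemma tripleEval_yb3 (s : A →ₗ[F] A →ₗ[F] A) (r t : A ⊗[F] A) (f g h : Module.Dual F A) :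
    tripleEval f g h (yb3 s (r ⊗ₜ[F] t)) = h (s (rMapL r f) (rMapL t g)) := by
  induction r with
  | zero => simp
  | add r r' hr hr' => simp [TensorProduct.add_tmul, hr, hr']
  | tmul x y =>
    induction t with
    | zero => simp
    | add t t' ht ht' => simp only [TensorProduct.tmul_add, map_add, LinearMap.add_apply, ht, ht']
    | tmul z w => simp [yb3, rMapL_tmul, tripleEval_tmul]; ring

lemma isPAFYBESolution_iff_dual [FiniteDimensional F A] (p s : A →ₗ[F] A →ₗ[F] A)
    {r : A ⊗[F] A} (hsymm : TensorProduct.comm F A A r = r) :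
    IsPAFYBESolution p s r ↔ ∀ f g h : Module.Dual F A,
      g (p (rMapL r h) (rMapL r f) + s (rMapL r h) (rMapL r f))
        = f (p (rMapL r g) (rMapL r h)) + h (s (rMapL r f) (rMapL r g)) := by
  have key (f g h : Module.Dual F A) :
      (tripleEval f g h (yb1 (p + s) (r ⊗ₜ[F] r))
        = tripleEval f g h (yb2 p (r ⊗ₜ[F] r) + yb3 s (r ⊗ₜ[F] r))) ↔
      g (p (rMapL r h) (rMapL r f) + s (rMapL r h) (rMapL r f))
        = f (p (rMapL r g) (rMapL r h)) + h (s (rMapL r f) (rMapL r g)) := by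
    rw [map_add, tripleEval_yb1, tripleEval_yb2, tripleEval_yb3, hsymm, LinearMap.add_apply,
      LinearMap.add_apply]
  simp_rw [← key]
  exact ⟨fun hr f g h => congrArg _ hr, tripleEval_ext⟩

end Pairing

/-- a symmetric nondegenerate `r` satisfies PAFYBE iff the bilinear form
`B(x,y) = ⟨r⁻¹(x), y⟩` satisfies `B(x·y, z) = B(y, z≺x) + B(x, y≻z)`. -/
theorem symm_nondeg_PAFYBE_iff_form
    {F A : Type*} [Field F] [CharZero F] [AddCommGroup A] [Module F A]
    [FiniteDimensional F A]
    (p s : A →ₗ[F] A →ₗ[F] A) (hA : IsPreAntiFlexible p s)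
    (r : A ⊗[F] A) (hsymm : (TensorProduct.comm F A A) r = r)
    (hbij : Function.Bijective (rMapL (F := F) (A := A) r)) :
    IsPAFYBESolution p s r ↔
      ∀ x y z : A,
        (LinearEquiv.ofBijective (rMapL (F := F) (A := A) r) hbij).symm (p x y + s x y) z
          = (LinearEquiv.ofBijective (rMapL (F := F) (A := A) r) hbij).symm y (p z x)
            + (LinearEquiv.ofBijective (rMapL (F := F) (A := A) r) hbij).symm x (s y z) := by
  rw [isPAFYBESolution_iff_dual p s hsymm]
  set e := LinearEquiv.ofBijective (rMapL (F := F) (A := A) r) hbij with he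
  have e_apply (f : Module.Dual F A) : rMapL r f = e f := rfl
  have form_symm (x y : A) : e.symm x y = e.symm y x := by
    have := dual_rMapL r (e.symm x) (e.symm y)
    rwa [hsymm, e_apply, e_apply, e.apply_symm_apply, e.apply_symm_apply] at this
  simp_rw [e_apply]
  constructor
  · intro H x y z
    simpa [form_symm _ z] using H (e.symm y) (e.symm z) (e.symm x)
  · intro H f g h
    simpa [form_symm _ (e g)] using H (e h) (e f) (e g)
end
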